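/- Fix n ≥ 2 and let F be the field of rational functions over ℚ in the 2n indeterminates x_0, x_1, …, x_n, x̄_{n−1}, …, x̄_1. Set a = (x_{n−1}x̄_{n−1} + x_n²)/(x_{n−1}x_n²) and define: y_0 = a²x_0; y_1 = a·(x_0 + x_1x̄_1)/x_0; y_i = a·(x_{i−1}x̄_{i−1} + x_ix̄_i)/x_{i−1} for 2 ≤ i ≤ n−1; y_n = a·x_n; ȳ_1 = a·x_0x_1x̄_1/(x_0 + x_1x̄_1); ȳ_i = a·x_{i−1}x_ix̄_i/(x_{i−1}x̄_{i−1} + x_ix̄_i) for 2 ≤ i ≤ n−1. Then with b = y_0y_1/(y_0 + y_1ȳ_1) one has b = a, and the inverse formulas recover x: x_0 = (y_0 + y_1ȳ_1)/(b·y_1); x_i = (y_iȳ_i + y_{i+1}ȳ_{i+1})/(b·y_{i+1}) for 1 ≤ i ≤ n−2; x_{n−1} = (y_{n−1}ȳ_{n−1} + y_n²)/(b·y_n²); x_n = y_n/b; x̄_i = y_iȳ_iy_{i+1}/(b·(y_iȳ_i + y_{i+1}ȳ_{i+1})) for 1 ≤ i ≤ n−2; x̄_{n−1} = y_{n−1}ȳ_{n−1}y_n²/(b·(y_{n−1}ȳ_{n−1}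 + y_n²)). In particular the map (x_0,…,x̄_1) ↦ (y_0,…,ȳ_{n−1}) is birational. -/

import Mathlib

noncomputable section

/-- The index set of the `2n` indeterminates `x_0, x_1, …, x_n, x̄_1, …, x̄_{n-1}`. -/
abbrev Vars6 (n : ℕ) : Type := Fin (n + 1) ⊕ Fin (n - 1)

/-- The field of rational functions over `ℚ` in the indeterminates
`x_0, x_1, …, x_n, x̄_{n-1}, …, x̄_1`. -/
abbrev F6 (n : ℕ) : Type := FractionRing (MvPolynomial (Vars6 n) ℚ)

/-- A polynomial that does not vanish at `(1, …, 1)` is nonzero as a rational function. -/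
lemma algebraMap_ne_zero_of_eval_one_ne_zero {n : ℕ} {p : MvPolynomial (Vars6 n) ℚ}
    (hp : MvPolynomial.eval (fun _ => 1) p ≠ 0) :
    algebraMap (MvPolynomial (Vars6 n) ℚ) (F6 n) p ≠ 0 := by
  rw [Ne, FaithfulSMul.algebraMap_eq_zero_iff]
  rintro rfl
  simp at hp

/-- The birational map `σ̄ : V(A_{2n}^{(2)†}) → V₂(A_{2n}^{(2)†})`: with
`b = y_0y_1/(y_0 + y_1ȳ_1)` one has `b = a`, and the stated inverse formulas
recover the original tuple `x`; in particular the map is birational. -/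
theorem stmt6 (n : ℕ) (hn : 2 ≤ n)
    (x xb : ℕ → F6 n)
    (hx : ∀ i (h : i ≤ n),
      x i = algebraMap (MvPolynomial (Vars6 n) ℚ) (F6 n)
        (MvPolynomial.X (Sum.inl ⟨i, by omega⟩)))
    (hxb : ∀ i (h1 : 1 ≤ i) (h2 : i ≤ n - 1),
      xb i = algebraMap (MvPolynomial (Vars6 n) ℚ) (F6 n)
        (MvPolynomial.X (Sum.inr ⟨i - 1, by omega⟩)))
    (a : F6 n) (ha : a = (x (n-1) * xb (n-1) + x n ^ 2) / (x (n-1) * x n ^ 2))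
    (y yb : ℕ → F6 n)
    (hy0 : y 0 = a ^ 2 * x 0)
    (hy1 : y 1 = a * (x 0 + x 1 * xb 1) / x 0)
    (hyi : ∀ i, 2 ≤ i → i ≤ n - 1 →
      y i = a * (x (i-1) * xb (i-1) + x i * xb i) / x (i-1))
    (hyn : y n = a * x n)
    (hyb1 : yb 1 = a * (x 0 * x 1 * xb 1) / (x 0 + x 1 * xb 1))
    (hybi : ∀ i, 2 ≤ i → i ≤ n - 1 →
      yb i = a * (x (i-1) * x i * xb i) / (x (i-1) * xb (i-1) + x i * xb i))
    (b : F6 n) (hb : b = y 0 * y 1 / (y 0 + y 1 * yb 1)) :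
    b = a ∧
    x 0 = (y 0 + y 1 * yb 1) / (b * y 1) ∧
    (∀ i, 1 ≤ i → i ≤ n - 2 →
      x i = (y i * yb i + y (i+1) * yb (i+1)) / (b * y (i+1))) ∧
    x (n-1) = (y (n-1) * yb (n-1) + y n ^ 2) / (b * y n ^ 2) ∧
    x n = y n / b ∧
    (∀ i, 1 ≤ i → i ≤ n - 2 →
      xb i = y i * yb i * y (i+1) / (b * (y i * yb i + y (i+1) * yb (i+1)))) ∧
    xb (n-1) = y (n-1) * yb (n-1) * y n ^ 2 / (b * (y (n-1) * yb (n-1) + y n ^ 2)) := by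
  have hX : ∀ i, i ≤ n → x i ≠ 0 := fun i hi => by
    rw [hx i hi]
    exact algebraMap_ne_zero_of_eval_one_ne_zero (by simp)
  have hS1 : x 0 + x 1 * xb 1 ≠ 0 := by
    rw [hx 0 (by omega), hx 1 (by omega), hxb 1 le_rfl (by omega), ← map_mul, ← map_add]
    exact algebraMap_ne_zero_of_eval_one_ne_zero (by norm_num)
  have hS : ∀ i, 2 ≤ i → i ≤ n - 1 → x (i-1) * xb (i-1) + x i * xb i ≠ 0 := fun i h1 h2 => by
    rw [hx (i-1) (by omega), hx i (by omega), hxb (i-1) (by omega) (by omega),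
      hxb i (by omega) h2, ← map_mul, ← map_mul, ← map_add]
    exact algebraMap_ne_zero_of_eval_one_ne_zero (by norm_num)
  have hT : x (n-1) * xb (n-1) + x n ^ 2 ≠ 0 := by
    rw [hx (n-1) (by omega), hx n le_rfl, hxb (n-1) (by omega) le_rfl,
      ← map_mul, ← map_pow, ← map_add]
    exact algebraMap_ne_zero_of_eval_one_ne_zero (by norm_num)
  have h0 := hX 0 (by omega)
  have hn0 := hX n le_rfl
  have hn1 := hX (n-1) (by omega)
  have ha0 : a ≠ 0 := by
    rw [ha]
    exact div_ne_zero hT (mul_ne_zero hn1 (pow_ne_zero 2 hn0))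
  have haT : x (n-1) * xb (n-1) + x n ^ 2 = a * (x (n-1) * x n ^ 2) := by
    rw [ha]
    field_simp
  have hyy : ∀ i, 1 ≤ i → i ≤ n - 1 → y i * yb i = a ^ 2 * (x i * xb i) := fun i h1 h2 => by
    obtain rfl | h3 := h1.eq_or_lt
    · rw [hy1, hyb1]
      field_simp
    · have hS' := hS i h3 h2
      have hX' := hX (i-1) (by omega)
      rw [hyi i h3 h2, hybi i h3 h2]
      generalize x (i-1) * xb (i-1) + x i * xb i = S at hS' ⊢
      field_simp
  have hsum0 : y 0 + y 1 * yb 1 = a ^ 2 * (x 0 + x 1 * xb 1) := by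
    rw [hy0, hyy 1 le_rfl (by omega)]
    ring
  have hsum : ∀ i, 1 ≤ i → i ≤ n - 2 → y i * yb i + y (i+1) * yb (i+1) =
      a ^ 2 * (x i * xb i + x (i+1) * xb (i+1)) := fun i h1 h2 => by
    rw [hyy i h1 (by omega), hyy (i+1) (by omega) (by omega)]
    ring
  have hsumn : y (n-1) * yb (n-1) + y n ^ 2 = a ^ 3 * (x (n-1) * x n ^ 2) := by
    rw [hyy (n-1) (by omega) le_rfl, hyn]
    linear_combination a ^ 2 * haT
  have hba : b = a := by
    rw [hb, hsum0, hy0, hy1]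
    field_simp
  rw [hba]
  refine ⟨rfl, ?_, fun i h1 h2 => ?_, ?_, ?_, fun i h1 h2 => ?_, ?_⟩
  · rw [hsum0, hy1]
    field_simp
  · have hS' := hS (i+1) (by omega) (by omega)
    have hX' := hX i (by omega)
    rw [hsum i h1 h2, hyi (i+1) (by omega) (by omega)]
    rw [Nat.add_sub_cancel] at hS' ⊢
    generalize x i * xb i + x (i+1) * xb (i+1) = S at hS' ⊢
    field_simp
  · rw [hsumn, hyn]
    field_simp
  · rw [hyn]
    field_simp
  · have hS' := hS (i+1) (by omega) (by omega)
    have hX' := hX i (by omega)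
    rw [hsum i h1 h2, hyy i h1 (by omega), hyi (i+1) (by omega) (by omega)]
    rw [Nat.add_sub_cancel] at hS' ⊢
    generalize x i * xb i + x (i+1) * xb (i+1) = S at hS' ⊢
    field_simp
  · rw [hsumn, hyy (n-1) (by omega) le_rfl, hyn]
    field_simp
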